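/- Let t be a linear head normal form (normal_ℓh(t)) and Φ ▷^(b,e,r) Γ ⊢ t : τ be a typing derivation in system ℓ. Then: (1) |t|_ℓh ≤ |Φ|_ℓ; (2) if Φ is tight then b = 0, e = 0, and r = |t|_ℓh; (3) if τ = neutral then t is linear head neutral (neutral_ℓh(t)). -/

import Mathlib

/-! Linear substitution calculus (LSC) and the multi type system ℓ. -/

namespace LSC

/-- Terms of the linear substitution calculus:
variables, abstractions, applications and explicit substitutions `t[x\u]`. -/
inductive Term : Type
  | var : ℕ → Term
  | lam : ℕ → Term → Term
  | app : Term → Term → Term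
  | es  : Term → ℕ → Term → Term

/-- Free variables of a term. -/
def fv : Term → Finset ℕ
  | Term.var x => {x}
  | Term.lam x t => fv t \ {x}
  | Term.app t u => fv t ∪ fv u
  | Term.es t x u => (fv t \ {x}) ∪ fv u

/-- Multi types: the two tight constants and arrow types whose source is a
finite multiset (represented as a list) of multi types. -/
inductive Ty : Type
  | neutral : Ty
  | abs : Ty
  | arrow : List Ty → Ty → Ty

/-- A type is tight when it is one of the two tight constants. -/
def tightTy (τ : Ty) : Prop := τ = Ty.neutral ∨ τ = Ty.abs

/-- A multiset of types is tight when all its elements are tight. -/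
def tightM (M : List Ty) : Prop := ∀ τ ∈ M, tightTy τ

/-- Typing contexts: maps from variables to finite multisets of types
(the empty multiset meaning that the variable is not in the domain). -/
def Ctx : Type := ℕ → List Ty

/-- Multiset union of typing contexts. -/
def Ctx.union (Γ Δ : Ctx) : Ctx := fun x => Γ x ++ Δ x

/-- Removing a variable from a typing context. -/
def Ctx.erase (Γ : Ctx) (x : ℕ) : Ctx := fun y => if y = x then [] else Γ y

/-- The typing context `x : M`. -/
def Ctx.single (x : ℕ) (M : List Ty) : Ctx := fun y => if y = x then M else []

/-- The empty typing context. -/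
def Ctx.empty : Ctx := fun _ => []

/-- A typing context is tight when all its multisets are tight. -/
def tightCtx (Γ : Ctx) : Prop := ∀ x, tightM (Γ x)

mutual
  /-- The type system ℓ: `Deriv Γ t τ b e r s` means that there is a typing
  derivation `Φ ▷^(b,e,r) Γ ⊢ t : τ` whose size (number of rules, not counting
  occurrences of the rule `many`) is `s`.  The index `r − |M|` of the rules
  `λ_b` and `ES` is rendered by writing the premise index as `r + |M|`. -/
  inductive Deriv : Ctx → Term → Ty → ℕ → ℕ → ℕ → ℕ → Prop
    | ax {x : ℕ} {τ : Ty} :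
        Deriv (Ctx.single x [τ]) (Term.var x) τ 0 0 1 1
    | lamB {Γ : Ctx} {x : ℕ} {t : Term} {τ : Ty} {b e r s : ℕ} :
        Deriv Γ t τ b e (r + (Γ x).length) s →
        Deriv (Γ.erase x) (Term.lam x t) (Ty.arrow (Γ x) τ)
          (b + 1) (e + (Γ x).length) r (s + 1)
    | lamR {Γ : Ctx} {x : ℕ} {t : Term} {τ : Ty} {b e r s : ℕ} :
        tightM (Γ x) → tightTy τ →
        Deriv Γ t τ b e r s →
        Deriv (Γ.erase x) (Term.lam x t) Ty.abs b e (r + 1) (s + 1)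
    | appB {Γ Δ : Ctx} {t u : Term} {M : List Ty} {τ : Ty} {b e r s b' e' r' s' : ℕ} :
        Deriv Γ t (Ty.arrow M τ) b e r s →
        DerivM Δ u M b' e' r' s' →
        Deriv (Γ.union Δ) (Term.app t u) τ (b + b' + 1) (e + e') (r + r') (s + s' + 1)
    | appR {Γ : Ctx} {t u : Term} {b e r s : ℕ} :
        Deriv Γ t Ty.neutral b e r s →
        Deriv Γ (Term.app t u) Ty.neutral b e (r + 1) (s + 1)
    | esR {Γ Δ : Ctx} {t : Term} {x : ℕ} {u : Term} {τ : Ty} {b e r s b' e' r' s' : ℕ} :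
        Deriv Γ t τ b e (r + (Γ x).length) s →
        DerivM Δ u (Γ x) b' e' r' s' →
        Deriv ((Γ.erase x).union Δ) (Term.es t x u) τ
          (b + b') (e + e' + (Γ x).length) (r + r') (s + s' + 1)

  /-- The rule `many`: a finite family of derivations typing the same term is
  merged, summing contexts and indices, to type it with the multiset of the types. -/
  inductive DerivM : Ctx → Term → List Ty → ℕ → ℕ → ℕ → ℕ → Prop
    | nil {t : Term} : DerivM Ctx.empty t [] 0 0 0 0
    | cons {Γ Δ : Ctx} {t : Term} {τ : Ty} {M : List Ty} {b e r s b' e' r' s' : ℕ} :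
        Deriv Γ t τ b e r s →
        DerivM Δ t M b' e' r' s' →
        DerivM (Γ.union Δ) t (τ :: M) (b + b') (e + e') (r + r') (s + s')
end

/-- `NeutralAt x t`: the predicate `neutral_x(t)` (linear head neutral with head
variable `x`). -/
inductive NeutralAt : ℕ → Term → Prop
  | var (x : ℕ) : NeutralAt x (Term.var x)
  | app {x : ℕ} {t : Term} (u : Term) : NeutralAt x t → NeutralAt x (Term.app t u)
  | es {x y : ℕ} {t : Term} (u : Term) : NeutralAt x t → y ≠ x →
      NeutralAt x (Term.es t y u)

/-- `NormalAt x t`: the predicate `normal_x(t)` (linear head normal with free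
head variable `x`). -/
inductive NormalAt : ℕ → Term → Prop
  | neutral {x : ℕ} {t : Term} : NeutralAt x t → NormalAt x t
  | lam {x y : ℕ} {t : Term} : NormalAt x t → y ≠ x → NormalAt x (Term.lam y t)
  | es {x y : ℕ} {t : Term} (u : Term) : NormalAt x t → y ≠ x →
      NormalAt x (Term.es t y u)

/-- `NormalO t`: the predicate `normal°(t)` (linear head normal with bound head
variable). -/
inductive NormalO : Term → Prop
  | lamAt {x : ℕ} {t : Term} : NormalAt x t → NormalO (Term.lam x t)
  | lamO {x : ℕ} {t : Term} : NormalO t → NormalO (Term.lam x t)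
  | es {y : ℕ} {t : Term} (u : Term) : NormalO t → NormalO (Term.es t y u)

/-- Linear head normal forms. -/
def NormalLH (t : Term) : Prop := (∃ x, NormalAt x t) ∨ NormalO t

/-- Linear head neutral terms. -/
def NeutralLH (t : Term) : Prop := ∃ x, NeutralAt x t

/-- Linear head abstractions (`abs_ℓh`), i.e. abstractions modulo ES. -/
inductive AbsLH : Term → Prop
  | lam {x : ℕ} {t : Term} : AbsLH (Term.lam x t)
  | es {x : ℕ} {t u : Term} : AbsLH t → AbsLH (Term.es t x u)

/-- Linear head size. -/
def lhSize : Term → ℕ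
  | Term.var _ => 1
  | Term.lam _ t => lhSize t + 1
  | Term.app t _ => lhSize t + 1
  | Term.es t _ _ => lhSize t

/-- Linear head contexts `H ::= ⟨·⟩ | λx.H | H t | H[x\t]`. -/
inductive HCtx : Type
  | hole : HCtx
  | lam : ℕ → HCtx → HCtx
  | app : HCtx → Term → HCtx
  | es : HCtx → ℕ → Term → HCtx

/-- Plugging a term in a linear head context. -/
def HCtx.plug : HCtx → Term → Term
  | HCtx.hole, t => t
  | HCtx.lam x H, t => Term.lam x (H.plug t)
  | HCtx.app H u, t => Term.app (H.plug t) u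
  | HCtx.es H x u, t => Term.es (H.plug t) x u

/-- The variables that a linear head context can capture. -/
def HCtx.binders : HCtx → Finset ℕ
  | HCtx.hole => ∅
  | HCtx.lam x H => insert x H.binders
  | HCtx.app H _ => H.binders
  | HCtx.es H x _ => insert x H.binders

/-- Substitution contexts `L ::= ⟨·⟩ | L[x\t]`. -/
inductive LCtx : Type
  | hole : LCtx
  | es : LCtx → ℕ → Term → LCtx

/-- Plugging a term in a substitution context. -/
def LCtx.plug : LCtx → Term → Term
  | LCtx.hole, t => t
  | LCtx.es L x u, t => Term.es (L.plug t) x u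

/-- `t` is of the form `H⟨x⟩` with `x` not captured by `H`. -/
def IsHeadVarOf (x : ℕ) (t : Term) : Prop :=
  ∃ H : HCtx, x ∉ H.binders ∧ t = H.plug (Term.var x)

/-- Multiplicative evaluation `→m`. -/
inductive MStep : Term → Term → Prop
  | beta {L : LCtx} {x : ℕ} {t u : Term} :
      MStep (Term.app (L.plug (Term.lam x t)) u) (L.plug (Term.es t x u))
  | lam {x : ℕ} {t t' : Term} : MStep t t' → MStep (Term.lam x t) (Term.lam x t')
  | app {t t' u : Term} : ¬ AbsLH t → MStep t t' →
      MStep (Term.app t u) (Term.app t' u)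
  | es {t t' u : Term} {x : ℕ} : ¬ IsHeadVarOf x t → MStep t t' →
      MStep (Term.es t x u) (Term.es t' x u)

/-- Exponential evaluation `→e`. -/
inductive EStep : Term → Term → Prop
  | sub {H : HCtx} {x : ℕ} {u : Term} :
      x ∉ H.binders → (∀ y ∈ fv u, y ∉ H.binders) →
      EStep (Term.es (H.plug (Term.var x)) x u) (Term.es (H.plug u) x u)
  | lam {x : ℕ} {t t' : Term} : EStep t t' → EStep (Term.lam x t) (Term.lam x t')
  | app {t t' u : Term} : ¬ AbsLH t → EStep t t' →
      EStep (Term.app t u) (Term.app t' u)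
  | es {t t' u : Term} {x : ℕ} : ¬ IsHeadVarOf x t → EStep t t' →
      EStep (Term.es t x u) (Term.es t' x u)

/-- Linear head evaluation `→ℓh` is the union of `→m` and `→e`. -/
def LHStep (t u : Term) : Prop := MStep t u ∨ EStep t u

/-- `Steps R k t u`: `t` evaluates to `u` in exactly `k` `R`-steps. -/
def Steps (R : Term → Term → Prop) : ℕ → Term → Term → Prop
  | 0, t, u => t = u
  | k + 1, t, u => ∃ p, R t p ∧ Steps R k p u

/-- `MESteps k₁ k₂ t u`: an evaluation sequence from `t` to `u` made of `k₁`
multiplicative steps and `k₂` exponential steps. -/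
inductive MESteps : ℕ → ℕ → Term → Term → Prop
  | refl (t : Term) : MESteps 0 0 t t
  | mstep {t p u : Term} {k₁ k₂ : ℕ} : MStep t p → MESteps k₁ k₂ p u →
      MESteps (k₁ + 1) k₂ t u
  | estep {t p u : Term} {k₁ k₂ : ℕ} : EStep t p → MESteps k₁ k₂ p u →
      MESteps k₁ (k₂ + 1) t u


theorem Ctx.erase_of_ne (Γ : Ctx) {x y : ℕ} (h : y ≠ x) : Γ.erase x y = Γ y := if_neg h

theorem Ctx.erase_self (Γ : Ctx) (x : ℕ) : Γ.erase x x = [] := if_pos rfl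

theorem DerivM.nil_inv {Δ : Ctx} {u : Term} {M : List Ty} {b e r s : ℕ}
    (D : DerivM Δ u M b e r s) (hM : M = []) :
    Δ = Ctx.empty ∧ b = 0 ∧ e = 0 ∧ r = 0 := by
  cases D with
  | nil => exact ⟨rfl, rfl, rfl, rfl⟩
  | cons => simp at hM

/-- The linear head size is bounded by the size of any typing derivation. -/
theorem lhSize_le_size (t : Term) {Γ : Ctx} {τ : Ty} {b e r s : ℕ}
    (D : Deriv Γ t τ b e r s) : lhSize t ≤ s := by
  induction t generalizing Γ τ b e r s with
  | var x => cases D; simp [lhSize]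
  | lam x t ih =>
    cases D with
    | lamB D => exact Nat.succ_le_succ (ih D)
    | lamR _ _ D => exact Nat.succ_le_succ (ih D)
  | app t u ih _ =>
    cases D with
    | appB D _ => have := ih D; simp only [lhSize]; omega
    | appR D => exact Nat.succ_le_succ (ih D)
  | es t x u ih _ =>
    cases D with
    | esR D _ => have := ih D; simp only [lhSize]; omega

/-- Inversion of the typing rule for explicit substitutions: if the substituted variable
is not in the typing context, then the argument contributes nothing. -/
theorem Deriv.es_inv {Γ' : Ctx} {t u : Term} {y : ℕ} {τ : Ty} {b e r s : ℕ}
    (D : Deriv Γ' (Term.es t y u) τ b e r s) :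
    ∃ Γ b' e' r' s', Deriv Γ t τ b' e' r' s' ∧ (∀ z ≠ y, Γ z ⊆ Γ' z) ∧
      (Γ y = [] → Γ' = Γ.erase y ∧ b = b' ∧ e = e' ∧ r = r') := by
  cases D with
  | @esR Γ Δ _ _ _ _ _ _ _ _ _ _ _ _ D DM =>
    refine ⟨Γ, _, _, _, _, D, fun z hz => ?_, fun hy => ?_⟩
    · simp [Ctx.union, Ctx.erase_of_ne Γ hz]
    · obtain ⟨rfl, rfl, rfl, rfl⟩ := DM.nil_inv hy
      refine ⟨?_, by simp [hy]⟩
      funext z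
      simp [Ctx.union, Ctx.empty]

theorem tightM.mono {M N : List Ty} (h : M ⊆ N) (hN : tightM N) : tightM M :=
  fun τ hτ => hN τ (h hτ)

/-- Tightness spreads on linear head neutral terms. -/
theorem NeutralAt.tight {x : ℕ} {t : Term} (h : NeutralAt x t) {Γ : Ctx} {τ : Ty}
    {b e r s : ℕ} (D : Deriv Γ t τ b e r s) (hx : tightM (Γ x)) :
    tightTy τ ∧ (∀ y ≠ x, Γ y = []) ∧ b = 0 ∧ e = 0 ∧ r = lhSize t := by
  induction h generalizing Γ τ b e r s with
  | var =>
    cases D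
    exact ⟨hx _ (by simp [Ctx.single]), fun y hy => if_neg hy, rfl, rfl, rfl⟩
  | app u _ ih =>
    cases D with
    | appB D _ =>
      have := (ih D (hx.mono (by simp [Ctx.union]))).1
      simp [tightTy] at this
    | appR D =>
      obtain ⟨hτ, hΓ, hb, he, hr⟩ := ih D hx
      exact ⟨hτ, hΓ, hb, he, congrArg Nat.succ hr⟩
  | @es y t u _ hne ih =>
    obtain ⟨Γ₀, b', e', r', s', D', hsub, hdis⟩ := D.es_inv
    obtain ⟨hτ, hΓ, hb, he, hr⟩ := ih D' (hx.mono (hsub _ hne.symm))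
    obtain ⟨rfl, rfl, rfl, rfl⟩ := hdis (hΓ y hne)
    refine ⟨hτ, fun z hz => ?_, hb, he, hr⟩
    simp [Ctx.erase, hΓ z hz]

/-- Tight typings of linear head normal terms with a free head variable. -/
theorem NormalAt.tight {x : ℕ} {t : Term} (h : NormalAt x t) {Γ : Ctx} {τ : Ty}
    {b e r s : ℕ} (D : Deriv Γ t τ b e r s) (hτ : tightTy τ) (hx : tightM (Γ x)) :
    (∀ y ≠ x, Γ y = []) ∧ b = 0 ∧ e = 0 ∧ r = lhSize t := by
  induction h generalizing Γ τ b e r s with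
  | neutral h => exact (h.tight D hx).2
  | @lam y t _ hne ih =>
    cases D with
    | lamB => simp [tightTy] at hτ
    | @lamR Γ _ _ _ _ _ _ _ _ hτ' D =>
      rw [Ctx.erase_of_ne Γ hne.symm] at hx
      obtain ⟨hΓ, hb, he, hr⟩ := ih D hτ' hx
      refine ⟨fun z hz => ?_, hb, he, congrArg Nat.succ hr⟩
      simp [Ctx.erase, hΓ z hz]
  | @es y t u _ hne ih =>
    obtain ⟨Γ₀, b', e', r', s', D', hsub, hdis⟩ := D.es_inv
    obtain ⟨hΓ, hb, he, hr⟩ := ih D' hτ (hx.mono (hsub _ hne.symm))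
    obtain ⟨rfl, rfl, rfl, rfl⟩ := hdis (hΓ y hne)
    refine ⟨fun z hz => ?_, hb, he, hr⟩
    simp [Ctx.erase, hΓ z hz]

/-- Tight typings of linear head normal terms with a bound head variable. -/
theorem NormalO.tight {t : Term} (h : NormalO t) {Γ : Ctx} {τ : Ty}
    {b e r s : ℕ} (D : Deriv Γ t τ b e r s) (hτ : tightTy τ) :
    (∀ y, Γ y = []) ∧ b = 0 ∧ e = 0 ∧ r = lhSize t := by
  induction h generalizing Γ τ b e r s with
  | @lamAt x t h =>
    cases D with
    | lamB => simp [tightTy] at hτ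
    | @lamR Γ _ _ _ _ _ _ _ hx hτ' D =>
      obtain ⟨hΓ, hb, he, hr⟩ := h.tight D hτ' hx
      refine ⟨fun z => ?_, hb, he, congrArg Nat.succ hr⟩
      by_cases hz : z = x
      · subst hz
        exact Ctx.erase_self Γ z
      · rw [Ctx.erase_of_ne Γ hz, hΓ z hz]
  | lamO _ ih =>
    cases D with
    | lamB => simp [tightTy] at hτ
    | lamR _ hτ' D =>
      obtain ⟨hΓ, hb, he, hr⟩ := ih D hτ'
      refine ⟨fun z => ?_, hb, he, congrArg Nat.succ hr⟩
      simp [Ctx.erase, hΓ z]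
  | @es y t u _ ih =>
    obtain ⟨Γ₀, b', e', r', s', D', hsub, hdis⟩ := D.es_inv
    obtain ⟨hΓ, hb, he, hr⟩ := ih D' hτ
    obtain ⟨rfl, rfl, rfl, rfl⟩ := hdis (hΓ y)
    refine ⟨fun z => ?_, hb, he, hr⟩
    simp [Ctx.erase, hΓ z]

theorem NormalAt.neutralAt {x : ℕ} {t : Term} (h : NormalAt x t) {Γ : Ctx}
    {b e r s : ℕ} (D : Deriv Γ t Ty.neutral b e r s) : NeutralAt x t := by
  induction h generalizing Γ b e r s with
  | neutral h => exact h
  | lam => cases D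
  | es u _ hne ih =>
    obtain ⟨_, _, _, _, _, D', _⟩ := D.es_inv
    exact NeutralAt.es u (ih D') hne

theorem NormalO.not_neutral {t : Term} (h : NormalO t) {Γ : Ctx}
    {b e r s : ℕ} : ¬ Deriv Γ t Ty.neutral b e r s := by
  intro D
  induction h generalizing Γ b e r s with
  | lamAt => cases D
  | lamO => cases D
  | es u _ ih =>
    obtain ⟨_, _, _, _, _, D', _⟩ := D.es_inv
    exact ih D'

/-- Properties of ℓ typings of linear head normal forms: size bound,
tightness, neutrality. -/
theorem lsc_normal_form_typings
    {Γ : Ctx} {t : Term} {τ : Ty} {b e r s : ℕ}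
    (ht : NormalLH t) (Φ : Deriv Γ t τ b e r s) :
    lhSize t ≤ s ∧
    (tightTy τ → tightCtx Γ → b = 0 ∧ e = 0 ∧ r = lhSize t) ∧
    (τ = Ty.neutral → NeutralLH t) := by
  refine ⟨lhSize_le_size t Φ, fun hτ hΓ => ?_, fun hτ => ?_⟩
  · rcases ht with ⟨x, h⟩ | h
    · exact (h.tight Φ hτ (hΓ x)).2
    · exact (h.tight Φ hτ).2
  · subst hτ
    rcases ht with ⟨x, h⟩ | h
    · exact ⟨x, h.neutralAt Φ⟩
    · exact absurd Φ h.not_neutral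

end LSC
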